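/- The quotient of the unit group of the quaternion algebra ℍ[ℤ[1/2]] by the central subgroup of scalar units ℤ[1/2]ˣ is isomorphic to the symmetric group S₄ on four letters; in particular this quotient group has exactly 24 elements. -/

import Mathlib

open Quaternion

noncomputable section

/-- The ring `ℤ[1/2]`, realized as the subring of `ℚ` generated by `1/2`. -/
def Zhalf : Subring ℚ := Subring.closure {(2 : ℚ)⁻¹}

/-- The central subgroup of scalar units of an `R`-algebra. -/
def scalarUnits (R A : Type*) [CommRing R] [Ring A] [Algebra R A] : Subgroup Aˣ :=
  (Units.map (algebraMap R A).toMonoidHom).range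

instance scalarUnits_normal (R A : Type*) [CommRing R] [Ring A] [Algebra R A] :
    (scalarUnits R A).Normal := by
  constructor
  intro n hn g
  obtain ⟨r, rfl⟩ := hn
  refine ⟨r, Units.ext ?_⟩
  simp only [Units.val_mul, Units.coe_map, RingHom.toMonoidHom_eq_coe, MonoidHom.coe_coe]
  rw [← Algebra.commutes (r : R) ((g : Aˣ) : A), mul_assoc, Units.mul_inv, mul_one]

open OnePoint Matrix

theorem Zhalf.exists_two_pow_mul_eq_intCast (x : Zhalf) : ∃ (k : ℕ) (m : ℤ), 2 ^ k * x = m := by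
  obtain ⟨x, hx⟩ := x
  suffices ∃ (k : ℕ) (m : ℤ), 2 ^ k * x = m by
    obtain ⟨k, m, h⟩ := this
    exact ⟨k, m, Subtype.ext (by push_cast; exact h)⟩
  induction hx using Subring.closure_induction with
  | mem x hx => exact ⟨1, 1, by simp [Set.mem_singleton_iff.1 hx]⟩
  | zero => exact ⟨0, 0, by simp⟩
  | one => exact ⟨0, 1, by simp⟩
  | add x y _ _ hx hy =>
    obtain ⟨k, m, hx⟩ := hx
    obtain ⟨l, n, hy⟩ := hy
    refine ⟨k + l, 2 ^ l * m + 2 ^ k * n, ?_⟩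
    push_cast
    rw [← hx, ← hy]
    ring
  | neg x _ hx =>
    obtain ⟨k, m, hx⟩ := hx
    exact ⟨k, -m, by push_cast; rw [← hx]; ring⟩
  | mul x y _ _ hx hy =>
    obtain ⟨k, m, hx⟩ := hx
    obtain ⟨l, n, hy⟩ := hy
    refine ⟨k + l, m * n, ?_⟩
    push_cast
    rw [← hx, ← hy]
    ring

theorem Zhalf.isUnit_two : IsUnit (2 : Zhalf) :=
  .of_mul_eq_one ⟨2⁻¹, Subring.subset_closure rfl⟩ <| Subtype.ext <|
    mul_inv_cancel₀ (two_ne_zero' ℚ)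

theorem Zhalf.exists_dvd_two_pow_of_isUnit {n : ℤ} (hn : IsUnit (n : Zhalf)) :
    ∃ k : ℕ, n ∣ 2 ^ k := by
  obtain ⟨y, hy⟩ := hn.exists_right_inv
  obtain ⟨k, m, hm⟩ := Zhalf.exists_two_pow_mul_eq_intCast y
  refine ⟨k, m, ?_⟩
  have h : ((2 ^ k : ℤ) : Zhalf) = ((n * m : ℤ) : Zhalf) := by
    push_cast
    linear_combination -(2 : Zhalf) ^ k * hy + n * hm
  exact_mod_cast h

theorem Zhalf.den_cast_ne_zero (x : Zhalf) : ((x : ℚ).den : ZMod 3) ≠ 0 := by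
  obtain ⟨k, m, h⟩ := Zhalf.exists_two_pow_mul_eq_intCast x
  have h : (2 : ℚ) ^ k * x = m := by
    simpa only [map_mul, map_pow, map_ofNat, map_intCast, Subring.subtype_apply]
      using congrArg Zhalf.subtype h
  have hx : (x : ℚ) = Rat.divInt m (2 ^ k) := by
    rw [Rat.divInt_eq_div, ← h]
    push_cast
    field_simp
  have hd : ((x : ℚ).den : ℤ) ∣ 2 ^ k := hx ▸ Rat.den_dvd m (2 ^ k)
  have hd : (x : ℚ).den ∣ 2 ^ k := by exact_mod_cast hd
  rw [Ne, ZMod.natCast_eq_zero_iff]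
  intro h3
  have := Nat.prime_three.dvd_of_dvd_pow (h3.trans hd)
  omega

/-- Reduction modulo `3` on `ℤ[1/2]`. -/
def Zhalf.toZModThree : Zhalf →+* ZMod 3 where
  toFun x := ((x : ℚ) : ZMod 3)
  map_zero' := by simp
  map_one' := by simp
  map_add' x y := Rat.cast_add_of_ne_zero (Zhalf.den_cast_ne_zero x) (Zhalf.den_cast_ne_zero y)
  map_mul' x y := Rat.cast_mul_of_ne_zero (Zhalf.den_cast_ne_zero x) (Zhalf.den_cast_ne_zero y)

/-- The splitting of the quaternion algebra over a ring of characteristic `3` sending `i` to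
`!![0, -1; 1, 0]` and `j` to `!![1, 1; 1, -1]`. -/
def quaternionToMatrix {R S : Type*} [CommRing R] [CommRing S] [CharP S 3] (f : R →+* S) :
    ℍ[R] →+* Matrix (Fin 2) (Fin 2) S where
  toFun q := !![f q.re + f q.imJ - f q.imK, -f q.imI + f q.imJ + f q.imK;
    f q.imI + f q.imJ + f q.imK, f q.re - f q.imJ + f q.imK]
  map_zero' := by ext i j; fin_cases i <;> fin_cases j <;> simp
  map_one' := by ext i j; fin_cases i <;> fin_cases j <;> simp
  map_add' p q := by ext i j; fin_cases i <;> fin_cases j <;> simp <;> ring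
  map_mul' p q := by
    have h3 : (3 : S) = 0 := by exact_mod_cast CharP.cast_eq_zero S 3
    ext i j
    fin_cases i <;> fin_cases j <;> simp [Matrix.mul_apply, Fin.sum_univ_two]
    · linear_combination (-f p.imJ * f q.imJ - f p.imK * f q.imK) * h3
    · linear_combination (f p.imK * f q.imJ - f p.imJ * f q.imK) * h3
    · linear_combination (f p.imJ * f q.imK - f p.imK * f q.imJ) * h3
    · linear_combination (-f p.imJ * f q.imJ - f p.imK * f q.imK) * h3

theorem quaternionToMatrix_apply {R S : Type*} [CommRing R] [CommRing S] [CharP S 3]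
    (f : R →+* S) (q : ℍ[R]) :
    quaternionToMatrix f q = !![f q.re + f q.imJ - f q.imK, -f q.imI + f q.imJ + f q.imK;
      f q.imI + f q.imJ + f q.imK, f q.re - f q.imJ + f q.imK] :=
  rfl

theorem ker_toPermHom_onePoint (K : Type*) [Field K] [DecidableEq K] :
    (MulAction.toPermHom (GL (Fin 2) K) (OnePoint K)).ker =
      (GeneralLinearGroup.scalar (Fin 2)).range := by
  ext g
  constructor
  · intro hg
    have hg (x : OnePoint K) : g • x = x := congrArg (fun σ : Equiv.Perm _ ↦ σ x) hg
    have hc : g 1 0 = 0 := smul_infty_eq_self_iff.1 (hg ∞)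
    have hdet : g 0 0 * g 1 1 ≠ 0 := by
      simpa [det_fin_two, hc] using g.det_ne_zero
    have hd : g 1 1 ≠ 0 := right_ne_zero_of_mul hdet
    have h (k : K) : g 0 0 * k + g 0 1 = k * g 1 1 := by
      have := hg k
      rw [smul_some_eq_ite, hc, if_neg (by simpa using hd), OnePoint.coe_eq_coe] at this
      exact (div_eq_iff (by simpa using hd)).1 (by simpa using this)
    have hb : g 0 1 = 0 := by simpa using h 0
    have ha : g 0 0 = g 1 1 := by simpa [hb] using h 1
    refine ⟨Units.mk0 _ hd, ?_⟩
    ext i j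
    fin_cases i <;> fin_cases j <;> simp [GeneralLinearGroup.coe_scalar, ha, hb, hc]
  · rintro ⟨u, rfl⟩
    rw [MonoidHom.mem_ker]
    ext x
    cases x with
    | infty => simp [smul_infty_eq_ite, GeneralLinearGroup.coe_scalar]
    | coe x => simp [smul_some_eq_ite, GeneralLinearGroup.coe_scalar]

theorem toPermHom_onePoint_zmod_three_surjective :
    Function.Surjective (MulAction.toPermHom (GL (Fin 2) (ZMod 3)) (OnePoint (ZMod 3))) := by
  set φ := MulAction.toPermHom (GL (Fin 2) (ZMod 3)) (OnePoint (ZMod 3)) with hφ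
  have hGL : Nat.card (GL (Fin 2) (ZMod 3)) = 48 := by
    rw [Matrix.card_GL_field, Fin.prod_univ_two, ZMod.card]
    rfl
  have hker : Nat.card φ.ker ≤ 2 := by
    rw [hφ, ker_toPermHom_onePoint]
    refine (Nat.card_le_card_of_surjective _ (MonoidHom.rangeRestrict_surjective _)).trans ?_
    rw [Nat.card_eq_fintype_card, ZMod.card_units_eq_totient]
    decide
  have hrange := φ.ker.card_mul_index
  rw [Subgroup.index_ker, hGL] at hrange
  have hperm : Nat.card (Equiv.Perm (OnePoint (ZMod 3))) = 24 := by
    have : Nat.card (OnePoint (ZMod 3)) = 4 := by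
      rw [show Nat.card (OnePoint (ZMod 3)) = Nat.card (Option (ZMod 3)) from rfl]
      simp
    rw [Nat.card_perm, this]
    rfl
  rw [← MonoidHom.range_eq_top]
  apply Subgroup.eq_top_of_le_card
  rw [hperm]
  nlinarith

theorem exists_eq_two_pow_mul_of_sum_sq_eq_two_pow (s : ℕ) (a b c d : ℤ)
    (h : a ^ 2 + b ^ 2 + c ^ 2 + d ^ 2 = 2 ^ s) :
    ∃ (t : ℕ) (a' b' c' d' : ℤ), a = 2 ^ t * a' ∧ b = 2 ^ t * b' ∧ c = 2 ^ t * c' ∧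
      d = 2 ^ t * d' ∧ a' ^ 2 + b' ^ 2 + c' ^ 2 + d' ^ 2 ≤ 4 := by
  induction s using Nat.strong_induction_on generalizing a b c d with
  | _ s ih =>
    rcases lt_or_ge s 3 with hs | hs
    · refine ⟨0, a, b, c, d, by simp, by simp, by simp, by simp, h.trans_le ?_⟩
      interval_cases s <;> norm_num
    · obtain ⟨r, rfl⟩ := Nat.exists_eq_add_of_le' hs
      have key : ∀ a b c d : ZMod 8, a ^ 2 + b ^ 2 + c ^ 2 + d ^ 2 = 0 →
          4 * a = 0 ∧ 4 * b = 0 ∧ 4 * c = 0 ∧ 4 * d = 0 := by decide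
      have h8 := congrArg (Int.cast : ℤ → ZMod 8) h
      rw [pow_add] at h8
      push_cast at h8
      rw [show (8 : ZMod 8) = 0 by decide, mul_zero] at h8
      have even (x : ℤ) (hx : 4 * (x : ZMod 8) = 0) : ∃ y, x = 2 * y := by
        have : ((4 * x : ℤ) : ZMod 8) = 0 := by exact_mod_cast hx
        rw [ZMod.intCast_zmod_eq_zero_iff_dvd] at this
        exact ⟨x / 2, by omega⟩
      obtain ⟨ha, hb, hc, hd⟩ := key _ _ _ _ h8
      obtain ⟨a, rfl⟩ := even a ha
      obtain ⟨b, rfl⟩ := even b hb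
      obtain ⟨c, rfl⟩ := even c hc
      obtain ⟨d, rfl⟩ := even d hd
      obtain ⟨t, a', b', c', d', rfl, rfl, rfl, rfl, h'⟩ := ih (r + 1) (by omega) a b c d (by
        rw [pow_add] at h ⊢
        linarith)
      exact ⟨t + 1, a', b', c', d', by ring, by ring, by ring, by ring, h'⟩

theorem Quaternion.isUnit_iff_isUnit_normSq {R : Type*} [CommRing R] {q : ℍ[R]} :
    IsUnit q ↔ IsUnit (normSq q) := by
  refine ⟨fun h ↦ h.map normSq, fun h ↦ ?_⟩
  have h : IsUnit ((normSq q : R) : ℍ[R]) := h.map (algebraMap R ℍ[R])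
  rw [← self_mul_star, (show Commute q (star q) from (star_comm_self' q).symm).isUnit_mul_iff] at h
  exact h.1

theorem im_eq_zero_of_toZModThree_eq_zero {w : ℍ[Zhalf]} (hw : IsUnit w)
    (hI : Zhalf.toZModThree w.imI = 0) (hJ : Zhalf.toZModThree w.imJ = 0)
    (hK : Zhalf.toZModThree w.imK = 0) : w.imI = 0 ∧ w.imJ = 0 ∧ w.imK = 0 := by
  obtain ⟨ka, a, ha⟩ := Zhalf.exists_two_pow_mul_eq_intCast w.re
  obtain ⟨kb, b, hb⟩ := Zhalf.exists_two_pow_mul_eq_intCast w.imI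
  obtain ⟨kc, c, hc⟩ := Zhalf.exists_two_pow_mul_eq_intCast w.imJ
  obtain ⟨kd, d, hd⟩ := Zhalf.exists_two_pow_mul_eq_intCast w.imK
  obtain ⟨N, a, b, c, d, ha, hb, hc, hd⟩ : ∃ (N : ℕ) (a b c d : ℤ), 2 ^ N * w.re = a ∧
      2 ^ N * w.imI = b ∧ 2 ^ N * w.imJ = c ∧ 2 ^ N * w.imK = d := by
    refine ⟨ka + kb + kc + kd, 2 ^ (kb + kc + kd) * a, 2 ^ (ka + kc + kd) * b,
      2 ^ (ka + kb + kd) * c, 2 ^ (ka + kb + kc) * d, ?_, ?_, ?_, ?_⟩ <;> push_cast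
    · rw [← ha]; ring
    · rw [← hb]; ring
    · rw [← hc]; ring
    · rw [← hd]; ring
  have hu : IsUnit ((a ^ 2 + b ^ 2 + c ^ 2 + d ^ 2 : ℤ) : Zhalf) := by
    push_cast
    rw [← ha, ← hb, ← hc, ← hd]
    convert ((Zhalf.isUnit_two.pow N).pow 2).mul (isUnit_iff_isUnit_normSq.1 hw) using 1
    rw [normSq_def']
    ring
  obtain ⟨k, hk⟩ := Zhalf.exists_dvd_two_pow_of_isUnit hu
  obtain ⟨s, -, hs⟩ := (Nat.dvd_prime_pow Nat.prime_two).1 (by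
    simpa [Int.natAbs_pow] using Int.natAbs_dvd_natAbs.2 hk)
  have hs : a ^ 2 + b ^ 2 + c ^ 2 + d ^ 2 = 2 ^ s := by
    rw [← Int.natAbs_of_nonneg (by positivity : 0 ≤ a ^ 2 + b ^ 2 + c ^ 2 + d ^ 2), hs]
    norm_num
  obtain ⟨t, a, b, c, d, rfl, rfl, rfl, rfl, h4⟩ :=
    exists_eq_two_pow_mul_of_sum_sq_eq_two_pow s a b c d hs
  have h2 : (2 : ZMod 3) ≠ 0 := by decide
  have key {x : Zhalf} {n : ℤ} (hx : Zhalf.toZModThree x = 0) (hxn : 2 ^ N * x = (2 ^ t * n : ℤ))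
      (hn : n ^ 2 ≤ 4) : x = 0 := by
    have h := congrArg Zhalf.toZModThree hxn
    rw [map_mul, hx, mul_zero, map_intCast] at h
    push_cast at h
    have h : (n : ZMod 3) = 0 := (mul_eq_zero.1 h.symm).resolve_left (pow_ne_zero _ h2)
    rw [ZMod.intCast_zmod_eq_zero_iff_dvd] at h
    have h₁ : n ≤ 2 := by nlinarith
    have h₂ : -2 ≤ n := by nlinarith
    obtain rfl : n = 0 := by push_cast at h; omega
    simpa [Zhalf.isUnit_two.ne_zero] using hxn
  exact ⟨key hI hb (by nlinarith), key hJ hc (by nlinarith), key hK hd (by nlinarith)⟩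

/-- The reduction modulo `3` of the unit group of `ℍ[ℤ[1/2]]`. -/
def unitsToGL : ℍ[Zhalf]ˣ →* GL (Fin 2) (ZMod 3) :=
  Units.map (quaternionToMatrix Zhalf.toZModThree).toMonoidHom

theorem coe_unitsToGL (w : ℍ[Zhalf]ˣ) :
    (unitsToGL w : Matrix (Fin 2) (Fin 2) (ZMod 3)) = quaternionToMatrix Zhalf.toZModThree w :=
  rfl

theorem unitsToGL_surjective : Function.Surjective unitsToGL := by
  intro g
  have key : ∀ x y z t : ZMod 3, x * t - y * z ≠ 0 →
      ∃ a ∈ Finset.Icc (-1 : ℤ) 1, ∃ b ∈ Finset.Icc (-1 : ℤ) 1, ∃ c ∈ Finset.Icc (-1 : ℤ) 1,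
        ∃ d ∈ Finset.Icc (-1 : ℤ) 1, a ^ 2 + b ^ 2 + c ^ 2 + d ^ 2 ∣ 4 ∧
          (a + c - d : ZMod 3) = x ∧ (-b + c + d : ZMod 3) = y ∧
          (b + c + d : ZMod 3) = z ∧ (a - c + d : ZMod 3) = t := by
    decide
  obtain ⟨a, -, b, -, c, -, d, -, h4, h₁, h₂, h₃, h₄⟩ := key (g 0 0) (g 0 1) (g 1 0) (g 1 1) (by
    simpa [det_fin_two] using g.det_ne_zero)
  let q : ℍ[Zhalf] := ⟨a, b, c, d⟩
  have hq : IsUnit q := by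
    rw [isUnit_iff_isUnit_normSq, normSq_def']
    refine isUnit_of_dvd_unit ?_ (Zhalf.isUnit_two.pow 2)
    convert (Int.castRingHom Zhalf).map_dvd h4 using 1 <;> simp [q]
    norm_num
  obtain ⟨w, hw⟩ := hq
  refine ⟨w, ?_⟩
  ext i j
  rw [coe_unitsToGL, hw, quaternionToMatrix_apply]
  fin_cases i <;> fin_cases j <;> simp [q, h₁, h₂, h₃, h₄]

theorem comap_unitsToGL_range_scalar :
    (GeneralLinearGroup.scalar (Fin 2)).range.comap unitsToGL = scalarUnits Zhalf ℍ[Zhalf] := by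
  ext w
  constructor
  · rintro ⟨u, hu⟩
    have h (i j : Fin 2) : Matrix.scalar (Fin 2) (u : ZMod 3) i j =
        quaternionToMatrix Zhalf.toZModThree w i j :=
      congrArg (fun g : GL (Fin 2) (ZMod 3) ↦ g i j) hu
    have h00 := h 0 0
    have h01 := h 0 1
    have h10 := h 1 0
    have h11 := h 1 1
    simp [quaternionToMatrix_apply] at h00 h01 h10 h11
    have key : ∀ u a b c d : ZMod 3, u = a + c - d → 0 = -b + c + d → 0 = b + c + d →
        u = a - c + d → b = 0 ∧ c = 0 ∧ d = 0 := by decide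
    obtain ⟨hI, hJ, hK⟩ := key _ _ _ _ _ h00 h01 h10 h11
    obtain ⟨hI, hJ, hK⟩ := im_eq_zero_of_toZModThree_eq_zero w.isUnit hI hJ hK
    have hw : (w : ℍ[Zhalf]) = algebraMap Zhalf ℍ[Zhalf] (w : ℍ[Zhalf]).re := by
      ext <;> simp [hI, hJ, hK]
    have hre : IsUnit (w : ℍ[Zhalf]).re := by
      have := isUnit_iff_isUnit_normSq.1 w.isUnit
      rw [normSq_def', hI, hJ, hK] at this
      simpa using this
    exact ⟨hre.unit, Units.ext hw.symm⟩
  · rintro ⟨r, rfl⟩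
    refine ⟨Units.map Zhalf.toZModThree.toMonoidHom r, ?_⟩
    ext i j
    fin_cases i <;> fin_cases j <;>
      simp [coe_unitsToGL, quaternionToMatrix_apply, GeneralLinearGroup.coe_scalar]

/-- The quotient of `ℍ[ℤ[1/2]]ˣ` by scalars permutes the four points of the projective line over
`𝔽₃` faithfully and as the full symmetric group. -/
def unitsModScalarsEquivPerm :
    (ℍ[Zhalf]ˣ ⧸ scalarUnits Zhalf ℍ[Zhalf]) ≃* Equiv.Perm (OnePoint (ZMod 3)) :=
  (QuotientGroup.quotientMulEquivOfEq (by
    rw [← comap_unitsToGL_range_scalar, ← ker_toPermHom_onePoint, MonoidHom.comap_ker])).trans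
    (QuotientGroup.quotientKerEquivOfSurjective
      ((MulAction.toPermHom (GL (Fin 2) (ZMod 3)) (OnePoint (ZMod 3))).comp unitsToGL)
      (toPermHom_onePoint_zmod_three_surjective.comp unitsToGL_surjective))

/-- The quotient of `ℍ[ℤ[1/2]]ˣ` by the central subgroup of scalar
units `ℤ[1/2]ˣ` is isomorphic to the symmetric group `S₄`; in particular it has exactly
`24` elements. -/
theorem hurwitz_units_mod_scalars_isS4 :
    Nonempty ((ℍ[Zhalf]ˣ ⧸ scalarUnits Zhalf ℍ[Zhalf]) ≃* Equiv.Perm (Fin 4)) ∧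
    Nat.card (ℍ[Zhalf]ˣ ⧸ scalarUnits Zhalf ℍ[Zhalf]) = 24 := by
  have e : (ℍ[Zhalf]ˣ ⧸ scalarUnits Zhalf ℍ[Zhalf]) ≃* Equiv.Perm (Fin 4) :=
    unitsModScalarsEquivPerm.trans (finSuccEquiv 3).symm.permCongrHom
  refine ⟨⟨e⟩, ?_⟩
  rw [Nat.card_congr e.toEquiv, Nat.card_perm, Nat.card_fin]
  rfl
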